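/- For all integers k ≥ 2, n ≥ 1, w ≥ 1: if there exists a length-n width-w ROBP over alphabet [k] that computes ApproxCount_k[n, n/(3(k−1))], then w ≥ n^{k−1}/(k! · 3^k). -/

import Mathlib

open Finset

/-- A length-`n` read-once branching program over alphabet `σ` with outputs in `Out`.
Layer `t` has vertex set `Fin (size t)` (only layers `0, 1, …, n` are relevant);
layer `0` consists of a single start vertex, and each vertex of layer `t` has an
outgoing edge to layer `t+1` for every letter of the alphabet. -/
structure ROBP (σ Out : Type) (n : ℕ) where
  size : ℕ → ℕ
  size0 : size 0 = 1
  sizePos : ∀ t, 0 < size t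
  step : (t : ℕ) → Fin (size t) → σ → Fin (size (t + 1))
  out : Fin (size n) → Out

namespace ROBP

variable {σ Out : Type} {n : ℕ}

/-- The vertex reached in layer `t` on input `x` (only `x 0, …, x (t-1)` matter). -/
def state (P : ROBP σ Out n) (x : ℕ → σ) : (t : ℕ) → Fin (P.size t)
  | 0 => ⟨0, P.sizePos 0⟩
  | t + 1 => P.step t (state P x t) (x t)

/-- The width of an ROBP: the maximal number of vertices in a single layer. -/
def width (P : ROBP σ Out n) : ℕ := (Finset.range (n + 1)).sup P.size

/-- Every vertex (in the relevant layers) is reached by some input: no useless vertices. -/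
def Reachable (P : ROBP σ Out n) : Prop :=
  ∀ t, t ≤ n → ∀ v : Fin (P.size t), ∃ x : ℕ → σ, P.state x t = v

/-- The output of the program on input `x`. -/
def eval (P : ROBP σ Out n) (x : ℕ → σ) : Out := P.out (P.state x n)

end ROBP

/-- The number of occurrences of `j` among `x 0, …, x (t-1)`. -/
def countK {k : ℕ} (x : ℕ → Fin k) (t : ℕ) (j : Fin k) : ℕ :=
  ((Finset.range t).filter fun i => x i = j).card

/-- `P` computes `ApproxCount_k[n, Δ]`: on every input, each of the `k` outputs estimates
the frequency of the corresponding letter within additive error `Δ`. -/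
def ComputesApproxCountK (k n : ℕ) (Δ : ℝ) (P : ROBP (Fin k) (Fin k → ℝ) n) : Prop :=
  ∀ x : ℕ → Fin k, ∀ j : Fin k, |P.eval x j - (countK x n j : ℝ)| ≤ Δ

/-- `P` computes `ApproxCount[n, Δ]` (the `{0,1}` case). -/
def ComputesApproxCount (n : ℕ) (Δ : ℝ) (P : ROBP Bool ℝ n) : Prop :=
  ∀ x : ℕ → Bool, |P.eval x - (((Finset.range n).filter fun i => x i = true).card : ℝ)| ≤ Δ

/-- The number of `1`'s in coordinate `j` among `x 0, …, x (t-1)`. -/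
def countPar {k : ℕ} (x : ℕ → (Fin k → Bool)) (t : ℕ) (j : Fin k) : ℕ :=
  ((Finset.range t).filter fun i => x i j = true).card

/-- `P` computes `ApproxCount^par_k[n, Δ]`. -/
def ComputesApproxCountPar (k n : ℕ) (Δ : ℝ) (P : ROBP (Fin k → Bool) (Fin k → ℝ) n) : Prop :=
  ∀ x : ℕ → (Fin k → Bool), ∀ j : Fin k, |P.eval x j - (countPar x n j : ℝ)| ≤ Δ

/-- The inclusion `[k-1] ⊆ [k]`. -/
def idx {k : ℕ} (j : Fin (k - 1)) : Fin k := Fin.castLE (Nat.sub_le k 1) j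

/-- `a_j(v)`: the minimal possible number of `j`'s in the first `t` input words
reaching the vertex `v` of layer `t`. -/
noncomputable def rectLo {k n : ℕ} (P : ROBP (Fin k) (Fin k → ℝ) n) (t : ℕ)
    (v : Fin (P.size t)) (j : Fin (k - 1)) : ℕ :=
  sInf {c | ∃ x : ℕ → Fin k, P.state x t = v ∧ countK x t (idx j) = c}

/-- `b_j(v)`: the maximal possible number of `j`'s in the first `t` input words
reaching the vertex `v` of layer `t`. -/
noncomputable def rectHi {k n : ℕ} (P : ROBP (Fin k) (Fin k → ℝ) n) (t : ℕ)
    (v : Fin (P.size t)) (j : Fin (k - 1)) : ℕ :=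
  sSup {c | ∃ x : ℕ → Fin k, P.state x t = v ∧ countK x t (idx j) = c}

/-- `a_j(v)` for the `k`-parallel case. -/
noncomputable def parLo {k n : ℕ} (P : ROBP (Fin k → Bool) (Fin k → ℝ) n) (t : ℕ)
    (v : Fin (P.size t)) (j : Fin k) : ℕ :=
  sInf {c | ∃ x : ℕ → (Fin k → Bool), P.state x t = v ∧ countPar x t j = c}

/-- `b_j(v)` for the `k`-parallel case. -/
noncomputable def parHi {k n : ℕ} (P : ROBP (Fin k → Bool) (Fin k → ℝ) n) (t : ℕ)
    (v : Fin (P.size t)) (j : Fin k) : ℕ :=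
  sSup {c | ∃ x : ℕ → (Fin k → Bool), P.state x t = v ∧ countPar x t j = c}

/-- The axis-parallel box `[lo 1, hi 1] × ⋯ × [lo m, hi m]` (as a set of integer points). -/
def rect {m : ℕ} (lo hi : Fin m → ℕ) : Set (Fin m → ℕ) :=
  {y | ∀ j, lo j ≤ y j ∧ y j ≤ hi j}

/-- The potential `φ_t(x)` of the point `x` (k-counter case): the maximum, over all
rectangle labels of layer `t` containing `x`, of `min{Σ_j b_j, t} - Σ_j x_j`. -/
noncomputable def phiK {k n : ℕ} (P : ROBP (Fin k) (Fin k → ℝ) n) (t : ℕ)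
    (x : Fin (k - 1) → ℕ) : ℕ :=
  Finset.univ.sup fun v : Fin (P.size t) =>
    if ∀ j, rectLo P t v j ≤ x j ∧ x j ≤ rectHi P t v j then
      min (∑ j, rectHi P t v j) t - ∑ j, x j
    else 0

/-- `T_{t,k}`: tuples of naturals summing to at most `t`. -/
def Tset (k t : ℕ) : Finset (Fin (k - 1) → ℕ) :=
  (Fintype.piFinset fun _ => Finset.range (t + 1)).filter fun x => ∑ j, x j ≤ t

/-- The total potential `Φ_t` of layer `t` (k-counter case). -/
noncomputable def PhiK {k n : ℕ} (P : ROBP (Fin k) (Fin k → ℝ) n) (t : ℕ) : ℕ :=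
  ∑ x ∈ Tset k t, phiK P t x

/-- The potential `φ_t(x)` of the point `x` (k-parallel case). -/
noncomputable def phiPar {k n : ℕ} (P : ROBP (Fin k → Bool) (Fin k → ℝ) n) (t : ℕ)
    (x : Fin k → ℕ) : ℕ :=
  Finset.univ.sup fun v : Fin (P.size t) =>
    if ∀ j, parLo P t v j ≤ x j ∧ x j ≤ parHi P t v j then
      (∑ j, parHi P t v j) - ∑ j, x j
    else 0

/-- The total potential `Φ_t` of layer `t` (k-parallel case): the sum of `φ_t(x)`
over `x ∈ {0, 1, …, ⌊n/10⌋}^k`. -/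
noncomputable def PhiPar {k n : ℕ} (P : ROBP (Fin k → Bool) (Fin k → ℝ) n) (t : ℕ) : ℕ :=
  ∑ x ∈ Fintype.piFinset (fun _ : Fin k => Finset.range (n / 10 + 1)), phiPar P t x

/-- The generalized binomial coefficient `C(x, m) = x (x-1) ⋯ (x-m+1) / m!`. -/
noncomputable def genChoose (x : ℝ) (m : ℕ) : ℝ :=
  (∏ i ∈ Finset.range m, (x - (i : ℝ))) / (Nat.factorial m : ℝ)

namespace ROBP

variable {σ Out : Type} {n : ℕ}

theorem state_congr (P : ROBP σ Out n) {x y : ℕ → σ} {t : ℕ} (h : ∀ i < t, x i = y i) :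
    P.state x t = P.state y t := by
  induction t with
  | zero => rfl
  | succ t ih =>
    simp only [state]
    rw [ih fun i hi => h i (hi.trans t.lt_succ_self), h t t.lt_succ_self]

theorem state_update_succ (P : ROBP σ Out n) (x : ℕ → σ) (t : ℕ) (c : σ) :
    P.state (Function.update x t c) (t + 1) = P.step t (P.state x t) c := by
  simp only [state, Function.update_self]
  rw [P.state_congr (y := x) fun i hi => Function.update_of_ne hi.ne _ _]

theorem size_le_width (P : ROBP σ Out n) {t : ℕ} (ht : t ≤ n) : P.size t ≤ P.width :=
  Finset.le_sup (f := P.size) (Finset.mem_range.2 (Nat.lt_succ_of_le ht))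

end ROBP

theorem countK_le {k : ℕ} (x : ℕ → Fin k) (t : ℕ) (j : Fin k) : countK x t j ≤ t := by
  simpa [countK] using Finset.card_filter_le (Finset.range t) fun i => x i = j

theorem countK_update_succ {k : ℕ} (x : ℕ → Fin k) (t : ℕ) (c j : Fin k) :
    countK (Function.update x t c) (t + 1) j = countK x t j + if c = j then 1 else 0 := by
  have h : ((Finset.range t).filter fun i => Function.update x t c i = j) =
      (Finset.range t).filter fun i => x i = j := by
    refine Finset.filter_congr fun i hi => ?_
    rw [Function.update_of_ne (Finset.mem_range.1 hi).ne]
  unfold countK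
  rw [Finset.range_add_one, Finset.filter_insert, Function.update_self, h]
  split_ifs <;> simp

theorem idx_injective {k : ℕ} : Function.Injective (idx (k := k)) :=
  Fin.castLE_injective (Nat.sub_le k 1)

theorem exists_ne_idx {k : ℕ} (hk : 0 < k) : ∃ c : Fin k, ∀ j : Fin (k - 1), c ≠ idx j := by
  refine ⟨⟨k - 1, by omega⟩, fun j hj => ?_⟩
  have h := congrArg Fin.val hj
  simp only [idx, Fin.val_castLE] at h
  omega

theorem exists_countK_eq {k : ℕ} (hk : 0 < k) (t : ℕ) (x : Fin (k - 1) → ℕ)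
    (hx : ∑ j, x j ≤ t) : ∃ y : ℕ → Fin k, ∀ j, countK y t (idx j) = x j := by
  induction t generalizing x with
  | zero =>
    refine ⟨fun _ => ⟨0, hk⟩, fun j => ?_⟩
    have := Finset.single_le_sum (f := x) (fun i _ => Nat.zero_le _) (Finset.mem_univ j)
    simp only [countK, Finset.range_zero, Finset.filter_empty, Finset.card_empty]
    omega
  | succ t ih =>
    by_cases h0 : ∃ j, 0 < x j
    · obtain ⟨j, hj⟩ := h0
      have hsum : ∑ i, x i = ∑ i, (x i - if i = j then 1 else 0) + 1 := by
        have : ∀ i, x i = (x i - if i = j then 1 else 0) + if i = j then 1 else 0 := by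
          intro i
          split_ifs with h
          · subst h; omega
          · omega
        rw [Finset.sum_congr rfl fun i _ => this i, Finset.sum_add_distrib]
        simp
      obtain ⟨y, hy⟩ := ih (fun i => x i - if i = j then 1 else 0) (by omega)
      refine ⟨Function.update y t (idx j), fun i => ?_⟩
      rw [countK_update_succ, hy]
      by_cases h : i = j
      · subst h; simp; omega
      · simp [h, idx_injective.eq_iff, Ne.symm h]
    · push Not at h0
      obtain ⟨c, hc⟩ := exists_ne_idx hk
      refine ⟨fun _ => c, fun j => ?_⟩
      have := h0 j
      simp [countK, hc j]
      omega

section Rectangles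

variable {k n : ℕ} (P : ROBP (Fin k) (Fin k → ℝ) n)

theorem rectLo_le_countK (y : ℕ → Fin k) (t : ℕ) (j : Fin (k - 1)) :
    rectLo P t (P.state y t) j ≤ countK y t (idx j) :=
  Nat.sInf_le ⟨y, rfl, rfl⟩

theorem countK_le_rectHi (y : ℕ → Fin k) (t : ℕ) (j : Fin (k - 1)) :
    countK y t (idx j) ≤ rectHi P t (P.state y t) j := by
  refine le_csSup ⟨t, ?_⟩ ⟨y, rfl, rfl⟩
  rintro c ⟨z, -, rfl⟩
  exact countK_le _ _ _

variable {P}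

theorem exists_countK_eq_rectLo (hP : P.Reachable) {t : ℕ} (ht : t ≤ n) (v : Fin (P.size t))
    (j : Fin (k - 1)) : ∃ y, P.state y t = v ∧ countK y t (idx j) = rectLo P t v j := by
  obtain ⟨x, hx⟩ := hP t ht v
  exact Nat.sInf_mem (s := {c | ∃ x : ℕ → Fin k, P.state x t = v ∧ countK x t (idx j) = c})
    ⟨_, x, hx, rfl⟩

theorem exists_countK_eq_rectHi (hP : P.Reachable) {t : ℕ} (ht : t ≤ n) (v : Fin (P.size t))
    (j : Fin (k - 1)) : ∃ y, P.state y t = v ∧ countK y t (idx j) = rectHi P t v j := by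
  obtain ⟨x, hx⟩ := hP t ht v
  refine Nat.sSup_mem (s := {c | ∃ x : ℕ → Fin k, P.state x t = v ∧ countK x t (idx j) = c})
    ⟨_, x, hx, rfl⟩ ⟨t, ?_⟩
  rintro c ⟨z, -, rfl⟩
  exact countK_le _ _ _

theorem rectLo_step_le (hP : P.Reachable) {t : ℕ} (ht : t ≤ n) (v : Fin (P.size t)) (c : Fin k)
    (j : Fin (k - 1)) :
    rectLo P (t + 1) (P.step t v c) j ≤ rectLo P t v j + if c = idx j then 1 else 0 := by
  obtain ⟨y, rfl, hy⟩ := exists_countK_eq_rectLo hP ht v j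
  rw [← hy, ← countK_update_succ, ← P.state_update_succ]
  exact rectLo_le_countK P _ _ _

theorem le_rectHi_step (hP : P.Reachable) {t : ℕ} (ht : t ≤ n) (v : Fin (P.size t)) (c : Fin k)
    (j : Fin (k - 1)) :
    (rectHi P t v j + if c = idx j then 1 else 0) ≤ rectHi P (t + 1) (P.step t v c) j := by
  obtain ⟨y, rfl, hy⟩ := exists_countK_eq_rectHi hP ht v j
  rw [← hy, ← countK_update_succ, ← P.state_update_succ]
  exact countK_le_rectHi P _ _ _

theorem le_phiK {t : ℕ} {x : Fin (k - 1) → ℕ} {v : Fin (P.size t)}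
    (hv : ∀ j, rectLo P t v j ≤ x j ∧ x j ≤ rectHi P t v j) :
    min (∑ j, rectHi P t v j) t - ∑ j, x j ≤ phiK P t x := by
  have := Finset.le_sup (f := fun v : Fin (P.size t) =>
    if ∀ j, rectLo P t v j ≤ x j ∧ x j ≤ rectHi P t v j then
      min (∑ j, rectHi P t v j) t - ∑ j, x j
    else 0) (Finset.mem_univ v)
  rw [if_pos hv] at this
  exact this

theorem exists_phiK_eq (hk : 0 < k) {t : ℕ} {x : Fin (k - 1) → ℕ} (hx : ∑ j, x j ≤ t) :
    ∃ v : Fin (P.size t), (∀ j, rectLo P t v j ≤ x j ∧ x j ≤ rectHi P t v j) ∧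
      phiK P t x = min (∑ j, rectHi P t v j) t - ∑ j, x j := by
  obtain ⟨y, hy⟩ := exists_countK_eq hk t x hx
  have hy' : ∀ j, rectLo P t (P.state y t) j ≤ x j ∧ x j ≤ rectHi P t (P.state y t) j :=
    fun j => by
      rw [← hy j]
      exact ⟨rectLo_le_countK P y t j, countK_le_rectHi P y t j⟩
  have : Nonempty (Fin (P.size t)) := ⟨P.state y t⟩
  obtain ⟨v, -, hv⟩ := Finset.exists_mem_eq_sup Finset.univ Finset.univ_nonempty
    fun v : Fin (P.size t) =>
      if ∀ j, rectLo P t v j ≤ x j ∧ x j ≤ rectHi P t v j then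
        min (∑ j, rectHi P t v j) t - ∑ j, x j
      else 0
  have hphi : phiK P t x = _ := hv
  split_ifs at hphi with h
  · exact ⟨v, h, hphi⟩
  · refine ⟨P.state y t, hy', ?_⟩
    have := le_phiK hy'
    omega

variable (P) in
/-- The gap between the largest conceivable potential `t - Σ_j x_j` and `φ_t(x)`. -/
noncomputable def deficiency (t : ℕ) (x : Fin (k - 1) → ℕ) : ℕ :=
  (t - ∑ j, x j) - phiK P t x

theorem deficiency_succ_le (hk : 0 < k) (hP : P.Reachable) {t : ℕ} (ht : t ≤ n)
    (x : Fin (k - 1) → ℕ) :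
    deficiency P (t + 1) x ≤
      deficiency P t x + if x ∈ Finset.univ.image (rectLo P t) then 1 else 0 := by
  unfold deficiency
  by_cases hx : ∑ j, x j ≤ t
  swap
  · omega
  obtain ⟨v, hv, hphi⟩ := exists_phiK_eq (P := P) hk hx
  have hsum : ∑ j, x j ≤ ∑ j, rectHi P t v j := Finset.sum_le_sum fun j _ => (hv j).2
  by_cases hcorner : ∃ j, rectLo P t v j < x j
  · obtain ⟨j, hj⟩ := hcorner
    have hlo := rectLo_step_le hP ht v (idx j)
    have hhi := le_rectHi_step hP ht v (idx j)
    have hmem : ∀ i, rectLo P (t + 1) (P.step t v (idx j)) i ≤ x i ∧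
        x i ≤ rectHi P (t + 1) (P.step t v (idx j)) i := by
      intro i
      have h1 := hlo i
      have h2 := hhi i
      have h3 := hv i
      by_cases h : j = i
      · subst h
        simp only [if_true] at h1 h2
        omega
      · simp only [idx_injective.eq_iff, h, if_false] at h1 h2
        omega
    have hgrow : ∑ i, rectHi P t v i + 1 ≤ ∑ i, rectHi P (t + 1) (P.step t v (idx j)) i := by
      have := Finset.sum_le_sum fun i (_ : i ∈ Finset.univ) => hhi i
      simpa [Finset.sum_add_distrib, idx_injective.eq_iff] using this
    have := le_phiK hmem
    omega
  · push Not at hcorner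
    have hxv : rectLo P t v = x := funext fun j => le_antisymm (hv j).1 (hcorner j)
    rw [if_pos (Finset.mem_image.2 ⟨v, Finset.mem_univ v, hxv⟩)]
    obtain ⟨c, hc⟩ := exists_ne_idx hk
    have hlo := rectLo_step_le hP ht v c
    have hhi := le_rectHi_step hP ht v c
    simp only [hc, if_false, add_zero] at hlo hhi
    have hgrow : ∑ i, rectHi P t v i ≤ ∑ i, rectHi P (t + 1) (P.step t v c) i :=
      Finset.sum_le_sum fun i _ => hhi i
    have := le_phiK fun i => ⟨(hlo i).trans (hv i).1, (hv i).2.trans (hhi i)⟩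
    omega

theorem sum_deficiency_le (hk : 0 < k) (hP : P.Reachable) (B : Finset (Fin (k - 1) → ℕ))
    {t : ℕ} (ht : t ≤ n) : ∑ x ∈ B, deficiency P t x ≤ t * P.width := by
  induction t with
  | zero => simp [deficiency]
  | succ t ih =>
    have ht' : t ≤ n := by omega
    calc ∑ x ∈ B, deficiency P (t + 1) x
        ≤ ∑ x ∈ B, (deficiency P t x +
            if x ∈ Finset.univ.image (rectLo P t) then 1 else 0) :=
          Finset.sum_le_sum fun x _ => deficiency_succ_le hk hP ht' x
      _ ≤ t * P.width + P.width := by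
          rw [Finset.sum_add_distrib, ← Finset.card_filter]
          refine add_le_add (ih ht') ?_
          calc _ ≤ (Finset.univ.image (rectLo P t)).card :=
                Finset.card_le_card fun x hx => (Finset.mem_filter.1 hx).2
            _ ≤ (Finset.univ : Finset (Fin (P.size t))).card := Finset.card_image_le
            _ = P.size t := by simp
            _ ≤ P.width := P.size_le_width ht'
      _ = (t + 1) * P.width := by ring

theorem rectHi_sub_rectLo_le (hP : P.Reachable) {Δ : ℝ} (hΔ : ComputesApproxCountK k n Δ P)
    (v : Fin (P.size n)) (j : Fin (k - 1)) :
    (rectHi P n v j : ℝ) - rectLo P n v j ≤ 2 * Δ := by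
  obtain ⟨y, hy, hyj⟩ := exists_countK_eq_rectHi hP le_rfl v j
  obtain ⟨z, hz, hzj⟩ := exists_countK_eq_rectLo hP le_rfl v j
  have h1 := abs_le.1 (hΔ y (idx j))
  have h2 := abs_le.1 (hΔ z (idx j))
  rw [ROBP.eval, hy, hyj] at h1
  rw [ROBP.eval, hz, hzj] at h2
  linarith [h1.1, h2.2]

theorem phiK_le (hk : 0 < k) (hP : P.Reachable) {Δ : ℝ} (hΔ : ComputesApproxCountK k n Δ P)
    {x : Fin (k - 1) → ℕ} (hx : ∑ j, x j ≤ n) :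
    (phiK P n x : ℝ) ≤ ((k : ℝ) - 1) * (2 * Δ) := by
  obtain ⟨v, hv, hphi⟩ := exists_phiK_eq (P := P) hk hx
  have hle : phiK P n x + ∑ j, x j ≤ ∑ j, rectHi P n v j := by
    have : ∑ j, x j ≤ ∑ j, rectHi P n v j := Finset.sum_le_sum fun j _ => (hv j).2
    omega
  have hlo : ∑ j, rectLo P n v j ≤ ∑ j, x j := Finset.sum_le_sum fun j _ => (hv j).1
  have hsum := Finset.sum_le_sum fun j (_ : j ∈ Finset.univ) => rectHi_sub_rectLo_le hP hΔ v j
  rw [Finset.sum_sub_distrib] at hsum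
  simp only [Finset.sum_const, Finset.card_univ, Fintype.card_fin, nsmul_eq_mul,
    Nat.cast_pred hk] at hsum
  have h1 : (phiK P n x : ℝ) + ∑ j, (x j : ℝ) ≤ ∑ j, (rectHi P n v j : ℝ) := by
    exact_mod_cast hle
  have h2 : ∑ j, (rectLo P n v j : ℝ) ≤ ∑ j, (x j : ℝ) := by exact_mod_cast hlo
  linarith

end Rectangles

theorem pow_succ_sub_pow_succ_le {a b : ℝ} (ha : 0 ≤ a) (hab : a ≤ b) (p : ℕ) :
    b ^ (p + 1) - a ^ (p + 1) ≤ (p + 1) * ((b - a) * b ^ p) := by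
  induction p with
  | zero => simp
  | succ p ih =>
    have hb : 0 ≤ b := ha.trans hab
    have h1 : (b - a) * a ^ (p + 1) ≤ (b - a) * b ^ (p + 1) :=
      mul_le_mul_of_nonneg_left (pow_le_pow_left₀ ha hab _) (sub_nonneg.2 hab)
    have h2 := mul_le_mul_of_nonneg_left ih hb
    have h3 : b ^ (p + 1 + 1) - a ^ (p + 1 + 1) =
        b * (b ^ (p + 1) - a ^ (p + 1)) + (b - a) * a ^ (p + 1) := by ring
    rw [h3]
    push_cast
    calc _ ≤ b * ((p + 1) * ((b - a) * b ^ p)) + (b - a) * b ^ (p + 1) := add_le_add h2 h1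
      _ = _ := by ring

theorem pow_div_le_sum_range {s : ℝ} (M p : ℕ) (hs : s ≤ M) :
    max s 0 ^ (p + 1) / (p + 1) ≤ ∑ i ∈ Finset.range M, max (s - i) 0 ^ p := by
  have hp : (0 : ℝ) < p + 1 := by positivity
  have key : ∀ i : ℕ, (max (s - i) 0 ^ (p + 1) - max (s - (i + 1 : ℕ)) 0 ^ (p + 1)) / (p + 1) ≤
      max (s - i) 0 ^ p := by
    intro i
    have hle : max (s - (i + 1 : ℕ)) 0 ≤ max (s - i) 0 := by
      push_cast
      exact max_le_max (by linarith) le_rfl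
    have hdiff : max (s - i) 0 - max (s - (i + 1 : ℕ)) 0 ≤ 1 := by
      push_cast
      rw [sub_le_iff_le_add]
      exact max_le (by linarith [le_max_left (s - (i + 1)) 0])
        (by linarith [le_max_right (s - (i + 1)) 0])
    rw [div_le_iff₀ hp, mul_comm]
    refine (pow_succ_sub_pow_succ_le (le_max_right _ _) hle p).trans ?_
    refine mul_le_mul_of_nonneg_left ?_ hp.le
    exact mul_le_of_le_one_left (pow_nonneg (le_max_right _ _) _) hdiff
  refine le_trans (le_of_eq ?_) (Finset.sum_le_sum fun i _ => key i)
  rw [← Finset.sum_div, Finset.sum_range_sub' fun i : ℕ => max (s - i) 0 ^ (p + 1)]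
  simp [max_eq_right (sub_nonpos.2 hs)]

theorem pow_div_factorial_le_sum (M m : ℕ) {s : ℝ} (hs : s ≤ M) :
    max s 0 ^ (m + 1) / (m + 1).factorial ≤
      ∑ x : Fin m → Fin M, max (s - ∑ j, ((x j : ℕ) : ℝ)) 0 := by
  induction m generalizing s with
  | zero => simp
  | succ m ih =>
    rw [← (Fin.consEquiv fun _ : Fin (m + 1) => Fin M).sum_comp, Fintype.sum_prod_type]
    have hstep : ∀ i : Fin M, max (s - (i : ℕ)) 0 ^ (m + 1) / (m + 1).factorial ≤
        ∑ y : Fin m → Fin M, max (s - ∑ j,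
          ((Fin.consEquiv (fun _ : Fin (m + 1) => Fin M) (i, y) j : ℕ) : ℝ)) 0 := by
      intro i
      refine (ih (s := s - (i : ℕ)) (by linarith [(Nat.cast_nonneg i : (0 : ℝ) ≤ (i : ℕ))])).trans
        (le_of_eq (Finset.sum_congr rfl fun y _ => ?_))
      rw [Fin.sum_univ_succ]
      simp [Fin.consEquiv, sub_sub]
    refine le_trans ?_ (Finset.sum_le_sum fun i _ => hstep i)
    rw [Fin.sum_univ_eq_sum_range fun i : ℕ => max (s - i) 0 ^ (m + 1) / (m + 1).factorial,
      ← Finset.sum_div, Nat.factorial_succ (m + 1), Nat.cast_mul, ← div_div]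
    gcongr
    simpa using pow_div_le_sum_range M (m + 1) hs

/-- if a length-`n` width-`w` ROBP over `[k]` computes
`ApproxCount_k[n, n/(3(k-1))]`, then `w ≥ n^{k-1} / (k! · 3^k)`. -/
theorem stmt5 (k n w : ℕ) (hk : 2 ≤ k) (hn : 1 ≤ n) (hw : 1 ≤ w)
    (h : ∃ P : ROBP (Fin k) (Fin k → ℝ) n, P.Reachable ∧ P.width ≤ w ∧
      ComputesApproxCountK k n ((n : ℝ) / (3 * ((k : ℝ) - 1))) P) :
    (w : ℝ) ≥ (n : ℝ) ^ (k - 1) / ((Nat.factorial k : ℝ) * 3 ^ k) := by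
  obtain ⟨P, hP, hPw, hΔ⟩ := h
  have hk0 : 0 < k := by omega
  have hk1 : (0 : ℝ) < (k : ℝ) - 1 := by
    have : (2 : ℝ) ≤ k := by exact_mod_cast hk
    linarith
  have hn0 : (0 : ℝ) < n := by exact_mod_cast hn
  have hpt : ∀ x : Fin (k - 1) → ℕ,
      max ((n : ℝ) / 3 - ∑ j, (x j : ℝ)) 0 ≤ deficiency P n x := by
    intro x
    refine max_le ?_ (Nat.cast_nonneg _)
    by_cases hx : ∑ j, x j ≤ n
    · have h1 := phiK_le hk0 hP hΔ hx
      have h2 : ((k : ℝ) - 1) * (2 * ((n : ℝ) / (3 * ((k : ℝ) - 1)))) = 2 * n / 3 := by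
        field_simp
      rw [h2] at h1
      have h3 : n ≤ deficiency P n x + phiK P n x + ∑ j, x j := by
        unfold deficiency
        omega
      have h4 : (n : ℝ) ≤ deficiency P n x + phiK P n x + ∑ j, (x j : ℝ) := by
        exact_mod_cast h3
      linarith
    · have h1 : (n : ℝ) < ∑ j, (x j : ℝ) := by exact_mod_cast not_le.1 hx
      linarith [(Nat.cast_nonneg _ : (0 : ℝ) ≤ deficiency P n x)]
  have hinj : Function.Injective fun (x : Fin (k - 1) → Fin n) j => (x j : ℕ) :=
    fun x y hxy => funext fun j => Fin.ext (congrFun hxy j)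
  have hupper := sum_deficiency_le hk0 hP
    (Finset.univ.image fun (x : Fin (k - 1) → Fin n) j => (x j : ℕ)) le_rfl
  rw [Finset.sum_image hinj.injOn] at hupper
  have hlower := pow_div_factorial_le_sum n (k - 1) (s := (n : ℝ) / 3) (by linarith)
  rw [Nat.sub_add_cancel hk0, max_eq_left (by positivity)] at hlower
  have hmain : ((n : ℝ) / 3) ^ k / k.factorial ≤ n * w :=
    calc _ ≤ ∑ x : Fin (k - 1) → Fin n, (deficiency P n fun j => (x j : ℕ) : ℝ) :=
          hlower.trans (Finset.sum_le_sum fun x _ => hpt _)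
      _ ≤ n * P.width := by exact_mod_cast hupper
      _ ≤ n * w := by gcongr
  have hpow : ((n : ℝ) / 3) ^ k / k.factorial = n * (n ^ (k - 1) / (k.factorial * 3 ^ k)) := by
    rw [div_pow, ← mul_pow_sub_one hk0.ne' (n : ℝ)]
    field_simp
  rw [hpow] at hmain
  exact le_of_mul_le_mul_left hmain hn0
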